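/- arXiv:2208.14830 — 2 statements merged into one kernel-verified Lean document; each statement's English description precedes it below -/
import Mathlib

section
/- Let θ = θ_1...θ_n be a finite word of positive integers and let q(·) denote the continuant of a word. Then q(11θ11) ≤ (5 + 2/θ_1 + 2/θ_n)·q(θ) and q(22θ22) ≥ (25 + 10/(θ_1+1) + 10/(θ_n+1))·q(θ). -/
/-- The continuant `K(c₁ … cₙ)`, i.e. the denominator of the finite continued
fraction `[0; c₁, …, cₙ]`, with `K([]) = 1`. -/
def contK : List ℕ → ℕ
  | [] => 1
  | [c] => c
  | c :: d :: l => c * contK (d :: l) + contK l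

/-- The numerator `p` of the finite continued fraction `[0; c₁, …, cₙ]`. -/
def contP : List ℕ → ℕ
  | [] => 0
  | _ :: t => contK t

/-- The size of the interval of numbers in `[0,1]` whose continued fraction
expansion begins with the word `w`. -/
noncomputable def cfsize (w : List ℕ) : ℝ :=
  1 / ((contK w : ℝ) * ((contK w : ℝ) + (contK w.dropLast : ℝ)))

/-- The Pell numbers, `P 0 = 0`, `P 1 = 1`, `P (k+1) = 2 P k + P (k-1)`. -/
def pell : ℕ → ℕ
  | 0 => 0
  | 1 => 1
  | n + 2 => 2 * pell (n + 1) + pell n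

theorem contK_append_pair (x y : ℕ) :
    ∀ l : List ℕ, contK (l ++ [x, y]) = y * contK (l ++ [x]) + contK l
  | [] => by simp [contK, mul_comm]
  | [c] => by simp [contK]; ring
  | c :: d :: l => by
    have ih := contK_append_pair x y (d :: l)
    have ih' := contK_append_pair x y l
    simp only [List.cons_append, contK] at ih ih' ⊢
    rw [ih, ih']
    ring

theorem mul_contK_le_contK_cons (c : ℕ) (l : List ℕ) : c * contK l ≤ contK (c :: l) := by
  cases l <;> simp [contK]

theorem contK_cons_le (c : ℕ) (l : List ℕ) (hl : ∀ x ∈ l, 0 < x) :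
    contK (c :: l) ≤ (c + 1) * contK l := by
  cases l with
  | nil => simp [contK]
  | cons d l =>
    have hd : 0 < d := hl d (by simp)
    have h := mul_contK_le_contK_cons d l
    simp only [contK]
    nlinarith [Nat.le_mul_of_pos_left (contK l) hd]

theorem mul_contK_le_contK_concat (c : ℕ) (l : List ℕ) :
    c * contK l ≤ contK (l ++ [c]) := by
  induction l using List.reverseRecOn with
  | nil => simp [contK]
  | append_singleton l d _ => simp [contK_append_pair]

theorem contK_concat_le (c : ℕ) (l : List ℕ) (hl : ∀ x ∈ l, 0 < x) :
    contK (l ++ [c]) ≤ (c + 1) * contK l := by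
  induction l using List.reverseRecOn with
  | nil => simp [contK]
  | append_singleton l d _ =>
    have hd : 0 < d := hl d (by simp)
    have h := mul_contK_le_contK_concat d l
    have e := contK_append_pair d c l
    simp only [List.append_assoc, List.cons_append, List.nil_append]
    nlinarith [Nat.le_mul_of_pos_left (contK l) hd]

/-- Euler's expansion of the continuant of a word of length at least two surrounded
by `xx` on both sides. -/
theorem contK_surround_pair (x a c : ℕ) (m : List ℕ) :
    contK (x :: x :: (a :: (m ++ [c]) ++ [x, x])) =
      (x ^ 2 + 1) ^ 2 * contK (a :: (m ++ [c])) + x * (x ^ 2 + 1) * contK (a :: m) +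
        x * (x ^ 2 + 1) * contK (m ++ [c]) + x ^ 2 * contK m := by
  have e1 := contK_append_pair x x (a :: (m ++ [c]))
  have e2 := contK_append_pair c x (a :: m)
  have e3 := contK_append_pair x x (m ++ [c])
  have e4 := contK_append_pair c x m
  simp only [List.cons_append, List.append_assoc, List.nil_append] at e1 e2 e3 e4 ⊢
  simp only [contK]
  rw [e1, e2, e3, e4]
  ring

/-- Continuant estimates for a word surrounded by `b = 11` or `a = 22`:
`q(11θ11) ≤ (5 + 2/θ₁ + 2/θₙ)·q(θ)` and
`q(22θ22) ≥ (25 + 10/(θ₁+1) + 10/(θₙ+1))·q(θ)`. -/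
theorem continuant_surround (θ : List ℕ) (t1 tn : ℕ) (hpos : ∀ c ∈ θ, 0 < c)
    (h1 : θ.head? = some t1) (h2 : θ.getLast? = some tn) :
    (contK (1 :: 1 :: (θ ++ [1, 1])) : ℝ)
        ≤ (5 + 2 / (t1 : ℝ) + 2 / (tn : ℝ)) * (contK θ : ℝ) ∧
      (contK (2 :: 2 :: (θ ++ [2, 2])) : ℝ)
        ≥ (25 + 10 / ((t1 : ℝ) + 1) + 10 / ((tn : ℝ) + 1)) * (contK θ : ℝ) := by
  rcases θ with _ | ⟨a, t⟩
  · simp at h1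
  obtain rfl : a = t1 := by simpa using h1
  have ha : 0 < a := hpos a (by simp)
  have ha' : (0 : ℝ) < a := by exact_mod_cast ha
  induction t using List.reverseRecOn with
  | nil =>
    obtain rfl : a = tn := by simpa using h2
    simp only [List.cons_append, List.nil_append, contK]
    push_cast
    constructor
    · have : (5 + 2 / (a : ℝ) + 2 / a) * a = 5 * a + 4 := by field_simp; ring
      rw [this]
      linarith
    · have : 10 / ((a : ℝ) + 1) * a ≤ 10 := by
        rw [div_mul_eq_mul_div, div_le_iff₀ (by positivity)]
        linarith
      linarith
  | append_singleton m c _ =>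
    obtain rfl : c = tn := by
      rw [← List.cons_append, List.getLast?_concat] at h2
      simpa using h2
    have hc : 0 < c := hpos c (by simp)
    have hc' : (0 : ℝ) < c := by exact_mod_cast hc
    have l1 := mul_contK_le_contK_cons a (m ++ [c])
    have l2 := mul_contK_le_contK_concat c (a :: m)
    have l3 := mul_contK_le_contK_concat c m
    have u1 := contK_cons_le a (m ++ [c]) fun x hx => hpos x (by simp_all)
    have u2 := contK_concat_le c (a :: m) fun x hx => hpos x (by
      rw [← List.cons_append]; exact List.mem_append_left _ hx)
    have hm : contK m ≤ contK (a :: (m ++ [c])) :=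
      (Nat.le_mul_of_pos_left _ hc).trans (l3.trans ((Nat.le_mul_of_pos_left _ ha).trans l1))
    rw [contK_surround_pair, contK_surround_pair]
    simp only [List.cons_append] at l2 u2
    generalize contK (a :: (m ++ [c])) = q at *
    generalize contK (m ++ [c]) = r at *
    generalize contK (a :: m) = s at *
    generalize contK m = k at *
    rify at l1 l2 u1 u2 hm
    push_cast
    constructor
    · have hr : (r : ℝ) ≤ q / a := by rw [le_div_iff₀ ha']; linarith
      have hs : (s : ℝ) ≤ q / c := by rw [le_div_iff₀ hc']; linarith
      have e : (5 + 2 / (a : ℝ) + 2 / c) * q = 5 * q + 2 * (q / a) + 2 * (q / c) := by ring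
      rw [e]
      linarith
    · have hr : (q : ℝ) / (a + 1) ≤ r := by rw [div_le_iff₀ (by positivity)]; linarith
      have hs : (q : ℝ) / (c + 1) ≤ s := by rw [div_le_iff₀ (by positivity)]; linarith
      have e : (25 + 10 / ((a : ℝ) + 1) + 10 / ((c : ℝ) + 1)) * q =
          25 * q + 10 * (q / (a + 1)) + 10 * (q / (c + 1)) := by ring
      have hk : (0 : ℝ) ≤ k := k.cast_nonneg
      rw [e]
      linarith
end

section
/- For each integer n, the number of elements of Σ(3, n) (the set of length-n factors of bi-infinite sequences in {1,2}^ℤ whose Markov value is at most 3) is at most 9n³. -/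
/-- Value of the finite continued fraction `[c₁; c₂, …, cₙ]`. -/
noncomputable def fcf : List ℕ → ℝ
  | [] => 0
  | c :: l => (c : ℝ) + 1 / fcf l

/-- Value of the infinite continued fraction `[a₀; a₁, a₂, …]`, obtained as the
supremum of the (increasing) even-indexed convergents. -/
noncomputable def cfVal (a : ℕ → ℕ) : ℝ :=
  ⨆ n : ℕ, fcf (List.ofFn fun i : Fin (2 * n + 1) => a i)

/-- `λ(ω) = [ω₀; ω₁, ω₂, …] + [0; ω₋₁, ω₋₂, …]` for a bi-infinite sequence. -/
noncomputable def lam (ω : ℤ → ℕ) : ℝ :=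
  cfVal (fun n => ω n) + 1 / cfVal (fun n => ω (-(n : ℤ) - 1))

/-! ### Continued fractions of positive integer sequences -/

/-- The `n`-th convergent `[a₀; a₁, …, aₙ₋₁]`. -/
noncomputable def convergent (n : ℕ) (a : ℕ → ℕ) : ℝ :=
  fcf (List.ofFn fun i : Fin n => a i)

theorem convergent_zero (a : ℕ → ℕ) : convergent 0 a = 0 := by
  simp [convergent, fcf]

theorem convergent_succ (n : ℕ) (a : ℕ → ℕ) :
    convergent (n + 1) a = a 0 + 1 / convergent n (fun i => a (i + 1)) := by
  simp [convergent, List.ofFn_succ, fcf]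

theorem convergent_nonneg (n : ℕ) (a : ℕ → ℕ) : 0 ≤ convergent n a := by
  induction n generalizing a with
  | zero => simp [convergent_zero]
  | succ n ih =>
    rw [convergent_succ]
    have := ih (fun i => a (i + 1))
    positivity

theorem one_le_convergent_succ (n : ℕ) {a : ℕ → ℕ} (ha : ∀ i, 0 < a i) :
    1 ≤ convergent (n + 1) a := by
  rw [convergent_succ]
  have h1 : (1 : ℝ) ≤ a 0 := by exact_mod_cast ha 0
  have h2 : 0 ≤ 1 / convergent n (fun i => a (i + 1)) :=
    one_div_nonneg.2 (convergent_nonneg _ _)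
  linarith

theorem convergent_le (n : ℕ) {a : ℕ → ℕ} (ha : ∀ i, 0 < a i) :
    convergent n a ≤ a 0 + 1 := by
  rcases n with _ | _ | n
  · rw [convergent_zero]; positivity
  · rw [convergent_succ, convergent_zero]; simp
  · rw [convergent_succ]
    have h := one_le_convergent_succ n (a := fun i => a (i + 1)) fun i => ha _
    have : 1 / convergent (n + 1) (fun i => a (i + 1)) ≤ 1 := by
      rw [div_le_one (by linarith)]; exact h
    linarith

theorem convergent_odd_le (n : ℕ) {a : ℕ → ℕ} (ha : ∀ i, 0 < a i) :
    convergent (2 * n + 1) a ≤ convergent (2 * (n + 1) + 1) a := by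
  induction n generalizing a with
  | zero =>
    have := convergent_nonneg 2 (fun i => a (i + 1))
    rw [convergent_succ, convergent_succ (2 * (0 + 1)), convergent_zero]
    simpa using this
  | succ n ih =>
    have h := ih (a := fun i => a (i + 1 + 1)) fun i => ha _
    have h1 := one_le_convergent_succ (2 * n) (a := fun i => a (i + 1 + 1)) fun i => ha _
    rw [show 2 * (n + 1) + 1 = 2 * n + 1 + 1 + 1 by ring,
      show 2 * (n + 1 + 1) + 1 = 2 * (n + 1) + 1 + 1 + 1 by ring,
      convergent_succ, convergent_succ (2 * n + 1), convergent_succ (2 * (n + 1) + 1 + 1),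
      convergent_succ (2 * (n + 1) + 1)]
    have h2 := h1.trans h
    gcongr

theorem abs_convergent_sub_le (n : ℕ) {a : ℕ → ℕ} (ha : ∀ i, 0 < a i) :
    |convergent (2 * n + 1) a - convergent (2 * n + 2) a| ≤ (1 / 4) ^ n := by
  induction n generalizing a with
  | zero =>
    have h := one_le_convergent_succ 0 (a := fun i => a (i + 1)) fun i => ha _
    rw [convergent_succ, convergent_succ (2 * 0 + 1), convergent_zero]
    simp only [div_zero, add_zero, pow_zero, sub_add_cancel_left, abs_neg, mul_zero]
    rw [abs_of_nonneg (by positivity), div_le_one (by linarith)]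
    exact h
  | succ n ih =>
    have h := ih (a := fun i => a (i + 1 + 1)) fun i => ha _
    have hx := one_le_convergent_succ (2 * n) (a := fun i => a (i + 1 + 1)) fun i => ha _
    have hy := one_le_convergent_succ (2 * n + 1) (a := fun i => a (i + 1 + 1)) fun i => ha _
    rw [show 2 * (n + 1) + 1 = 2 * n + 1 + 1 + 1 by ring,
      show 2 * (n + 1) + 2 = 2 * n + 2 + 1 + 1 by ring,
      convergent_succ, convergent_succ (2 * n + 1), convergent_succ (2 * n + 2 + 1),
      convergent_succ (2 * n + 2)]
    change 1 ≤ convergent (2 * n + 2) _ at hy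
    generalize convergent (2 * n + 1) (fun i => a (i + 1 + 1)) = x at *
    generalize convergent (2 * n + 2) (fun i => a (i + 1 + 1)) = y at *
    have hd : (1 : ℝ) ≤ a (0 + 1) := by exact_mod_cast ha _
    generalize ((a (0 + 1) : ℕ) : ℝ) = d at *
    have hx0 : 0 < x := by linarith
    have hy0 : 0 < y := by linarith
    have e : (a 0 : ℝ) + 1 / (d + 1 / x) - (a 0 + 1 / (d + 1 / y))
        = (x - y) / ((d * x + 1) * (d * y + 1)) := by
      have : d * x + 1 ≠ 0 := by positivity
      have : d * y + 1 ≠ 0 := by positivity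
      field_simp
      ring
    have h1 : 2 ≤ d * x + 1 := by nlinarith
    have h2 : 2 ≤ d * y + 1 := by nlinarith
    rw [e, abs_div, abs_of_pos (by positivity : 0 < (d * x + 1) * (d * y + 1)), pow_succ,
      div_le_iff₀ (by positivity)]
    have h4 : 4 ≤ (d * x + 1) * (d * y + 1) := by nlinarith
    have : 0 ≤ (1 / 4 : ℝ) ^ n := by positivity
    nlinarith

theorem tendsto_convergent_odd {a : ℕ → ℕ} (ha : ∀ i, 0 < a i) :
    Filter.Tendsto (fun n => convergent (2 * n + 1) a) Filter.atTop (nhds (cfVal a)) :=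
  tendsto_atTop_ciSup (monotone_nat_of_le_succ fun n => convergent_odd_le n ha)
    ⟨a 0 + 1, by rintro _ ⟨n, rfl⟩; exact convergent_le _ ha⟩

theorem cfVal_pos {a : ℕ → ℕ} (ha : ∀ i, 0 < a i) : 0 < cfVal a := by
  have := ge_of_tendsto' (tendsto_convergent_odd ha) fun n => one_le_convergent_succ (2 * n) ha
  linarith

theorem cfVal_eq {a : ℕ → ℕ} (ha : ∀ i, 0 < a i) :
    cfVal a = a 0 + 1 / cfVal (fun i => a (i + 1)) := by
  have hb : ∀ i, 0 < a (i + 1) := fun i => ha _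
  have h1 := tendsto_convergent_odd hb
  have h0 : Filter.Tendsto (fun n => convergent (2 * n + 1) (fun i => a (i + 1)) -
      convergent (2 * n + 2) (fun i => a (i + 1))) Filter.atTop (nhds 0) :=
    squeeze_zero_norm (fun n => abs_convergent_sub_le n hb)
      (tendsto_pow_atTop_nhds_zero_of_lt_one (by norm_num) (by norm_num))
  have h2 := h1.sub h0
  simp only [sub_sub_cancel, sub_zero] at h2
  have h3 := (tendsto_const_nhds (x := (a 0 : ℝ))).add
    ((tendsto_const_nhds (x := (1 : ℝ))).div h2 (cfVal_pos hb).ne')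
  refine tendsto_nhds_unique ((Filter.tendsto_add_atTop_iff_nat 1).2 (tendsto_convergent_odd ha)) ?_
  refine h3.congr fun n => ?_
  rw [show 2 * (n + 1) + 1 = 2 * n + 2 + 1 by ring, convergent_succ]
  rfl

theorem lt_cfVal {a : ℕ → ℕ} (ha : ∀ i, 0 < a i) : (a 0 : ℝ) < cfVal a := by
  rw [cfVal_eq ha]
  have := cfVal_pos (a := fun i => a (i + 1)) fun i => ha _
  have : 0 < 1 / cfVal (fun i => a (i + 1)) := by positivity
  linarith

theorem one_lt_cfVal {a : ℕ → ℕ} (ha : ∀ i, 0 < a i) : 1 < cfVal a := by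
  have h : (1 : ℝ) ≤ a 0 := by exact_mod_cast ha 0
  exact h.trans_lt (lt_cfVal ha)

theorem cfVal_lt {a : ℕ → ℕ} (ha : ∀ i, 0 < a i) : cfVal a < a 0 + 1 := by
  rw [cfVal_eq ha]
  have h := one_lt_cfVal (a := fun i => a (i + 1)) fun i => ha _
  have : 1 / cfVal (fun i => a (i + 1)) < 1 := by rw [div_lt_one (by linarith)]; exact h
  linarith

/-- Continued fractions are ordered by the alternating lexicographic order of their digits. -/
theorem cfVal_lex (r : ℕ) {a b : ℕ → ℕ} (ha : ∀ i, 0 < a i) (hb : ∀ i, 0 < b i)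
    (hab : ∀ i < r, a i = b i) (hr : a r < b r) :
    (Even r → cfVal a < cfVal b) ∧ (Odd r → cfVal b < cfVal a) := by
  induction r generalizing a b with
  | zero =>
    refine ⟨fun _ => ?_, fun h => absurd h (by decide)⟩
    have h1 : (a 0 : ℝ) + 1 ≤ b 0 := by exact_mod_cast hr
    linarith [cfVal_lt ha, lt_cfVal hb]
  | succ r ih =>
    have h0 : a 0 = b 0 := hab 0 (by omega)
    obtain ⟨h1, h2⟩ := ih (a := fun i => a (i + 1)) (b := fun i => b (i + 1))
      (fun i => ha _) (fun i => hb _) (fun i hi => hab _ (by omega)) hr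
    have pa := cfVal_pos (a := fun i => a (i + 1)) fun i => ha _
    have pb := cfVal_pos (a := fun i => b (i + 1)) fun i => hb _
    rw [cfVal_eq ha, cfVal_eq hb, h0]
    constructor
    · intro h
      have h := h2 (by rcases h with ⟨k, hk⟩; exact ⟨k - 1, by omega⟩)
      gcongr
    · intro h
      have h := h1 (by rcases h with ⟨k, hk⟩; exact ⟨k, by omega⟩)
      gcongr

/-- If `f = x^m y…` with `m` odd, and `g` does not begin with an odd run of `x` of length at
most `m`, then `f` and `g` are ordered as the two digits `x`, `y`. -/
theorem cfVal_odd_run {f g : ℕ → ℕ} {x y m : ℕ} (hf : ∀ i, 0 < f i) (hg : ∀ i, 0 < g i)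
    (hgxy : ∀ i, g i = x ∨ g i = y) (hm : Odd m)
    (hfx : ∀ i < m, f i = x) (hfy : f m = y)
    (hodd : ∀ n ≤ m, Odd n → (∀ i < n, g i = x) → g n ≠ y) :
    (x < y → cfVal f < cfVal g) ∧ (y < x → cfVal g < cfVal f) := by
  classical
  by_cases h : ∃ n ≤ m, g n ≠ x
  · have hlt : ∀ i < Nat.find h, g i = x := fun i hi => by
      by_contra hne
      exact Nat.find_min h hi ⟨(hi.le.trans (Nat.find_spec h).1), hne⟩
    obtain ⟨hnm, hnx⟩ := Nat.find_spec h
    generalize Nat.find h = n at *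
    have hny : g n = y := (hgxy n).resolve_left hnx
    have hev : Even n := by
      by_contra ho
      exact hodd n hnm (Nat.not_even_iff_odd.1 ho) hlt hny
    have hn : n < m := lt_of_le_of_ne hnm (by rintro rfl; exact Nat.not_even_iff_odd.2 hm hev)
    constructor
    · intro hxy
      exact (cfVal_lex n hf hg (fun i hi => by rw [hfx i (by omega), hlt i hi])
        (by rw [hfx n hn, hny]; exact hxy)).1 hev
    · intro hxy
      exact (cfVal_lex n hg hf (fun i hi => by rw [hfx i (by omega), hlt i hi])
        (by rw [hfx n hn, hny]; exact hxy)).1 hev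
  · push Not at h
    constructor
    · intro hxy
      exact (cfVal_lex m hg hf (fun i hi => by rw [hfx i hi, h i hi.le])
        (by rw [hfy, h m le_rfl]; exact hxy)).2 hm
    · intro hxy
      exact (cfVal_lex m hf hg (fun i hi => by rw [hfx i hi, h i hi.le])
        (by rw [hfy, h m le_rfl]; exact hxy)).2 hm

/-! ### Sequences with Markov value at most `3` -/

/-- `[ωₖ; ωₖ₊₁, …]` -/
noncomputable def rightVal (ω : ℤ → ℕ) (k : ℤ) : ℝ := cfVal fun n => ω (k + n)

/-- `[ωₖ; ωₖ₋₁, …]` -/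
noncomputable def leftVal (ω : ℤ → ℕ) (k : ℤ) : ℝ := cfVal fun n => ω (k - n)

/-- Positive integer sequences all of whose shifts have `λ ≤ 3`, stated symmetrically with
respect to reversal. -/
def IsMarkov (ω : ℤ → ℕ) : Prop :=
  (∀ i, 0 < ω i) ∧ ∀ k, (ω k : ℝ) + 1 / rightVal ω (k + 1) + 1 / leftVal ω (k - 1) ≤ 3

section
variable {ω : ℤ → ℕ}

theorem rightVal_eq (h : ∀ i, 0 < ω i) (k : ℤ) :
    rightVal ω k = ω k + 1 / rightVal ω (k + 1) := by
  rw [rightVal, cfVal_eq fun i => h _, rightVal]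
  simp only [Nat.cast_zero, add_zero, Nat.cast_succ]
  congr! 5
  ring

theorem leftVal_eq (h : ∀ i, 0 < ω i) (k : ℤ) :
    leftVal ω k = ω k + 1 / leftVal ω (k - 1) := by
  rw [leftVal, cfVal_eq fun i => h _, leftVal]
  simp only [Nat.cast_zero, sub_zero, Nat.cast_succ]
  congr! 5
  ring

theorem isMarkov_of_lam_le (h : ∀ i, 0 < ω i) (hl : ∀ k : ℤ, lam (fun i => ω (i + k)) ≤ 3) :
    IsMarkov ω := by
  refine ⟨h, fun k => ?_⟩
  rw [← rightVal_eq h]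
  refine le_of_eq_of_le ?_ (hl k)
  simp only [lam, rightVal, leftVal, add_comm k, sub_add_eq_add_sub, neg_add_eq_sub,
    sub_right_comm k]

theorem one_lt_rightVal (h : ∀ i, 0 < ω i) (k : ℤ) : 1 < rightVal ω k :=
  one_lt_cfVal fun _ => h _

theorem one_lt_leftVal (h : ∀ i, 0 < ω i) (k : ℤ) : 1 < leftVal ω k :=
  one_lt_cfVal fun _ => h _

theorem IsMarkov.reverse (h : IsMarkov ω) : IsMarkov fun i => ω (-i) := by
  refine ⟨fun i => h.1 _, fun k => ?_⟩
  have := h.2 (-k)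
  have e1 : rightVal (fun i => ω (-i)) (k + 1) = leftVal ω (-k - 1) := by
    unfold rightVal leftVal
    congr! 2
    ring_nf
  have e2 : leftVal (fun i => ω (-i)) (k - 1) = rightVal ω (-k + 1) := by
    unfold rightVal leftVal
    congr! 2
    ring_nf
  rw [e1, e2]
  linarith

theorem IsMarkov.eq_one_or_two (h : IsMarkov ω) (k : ℤ) : ω k = 1 ∨ ω k = 2 := by
  have h1 := h.1 k
  have h2 := h.2 k
  have h3 : 0 < 1 / rightVal ω (k + 1) := by have := one_lt_rightVal h.1 (k + 1); positivity
  have h4 : 0 < 1 / leftVal ω (k - 1) := by have := one_lt_leftVal h.1 (k - 1); positivity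
  have h5 : (ω k : ℝ) < 3 := by linarith
  have h6 : ω k < 3 := by exact_mod_cast h5
  omega

theorem IsMarkov.not_121 (h : IsMarkov ω) (k : ℤ) (h1 : ω k = 2) (h2 : ω (k + 1) = 1) :
    ω (k - 1) = 2 := by
  refine (h.eq_one_or_two _).resolve_left fun h3 => ?_
  have hk := h.2 k
  rw [rightVal_eq h.1, leftVal_eq h.1, h1, h2, h3] at hk
  have hx := one_lt_rightVal h.1 (k + 1 + 1)
  have hy := one_lt_leftVal h.1 (k - 1 - 1)
  generalize rightVal ω (k + 1 + 1) = x at *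
  generalize leftVal ω (k - 1 - 1) = y at *
  have key : ∀ z : ℝ, 1 < z → 1 / 2 < 1 / (1 + 1 / z) := fun z hz => by
    have : 1 / z < 1 := by rw [div_lt_one (by linarith)]; exact hz
    have : 0 < 1 / z := by positivity
    apply one_div_lt_one_div_of_lt <;> linarith
  have := key x hx
  have := key y hy
  push_cast at hk
  linarith

theorem IsMarkov.not_212 (h : IsMarkov ω) (k : ℤ) (h1 : ω k = 2) (h2 : ω (k + 1) = 1) :
    ω (k + 2) = 1 := by
  refine (h.eq_one_or_two _).resolve_right fun h3 => ?_
  have hk := h.2 k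
  have h4 := h.not_121 k h1 h2
  rw [rightVal_eq h.1, rightVal_eq h.1 (k + 1 + 1), leftVal_eq h.1, add_assoc k 1 1,
    one_add_one_eq_two, h1, h2, h3, h4] at hk
  have hx := one_lt_rightVal h.1 (k + 2 + 1)
  have hy := one_lt_leftVal h.1 (k - 1 - 1)
  generalize rightVal ω (k + 2 + 1) = x at *
  generalize leftVal ω (k - 1 - 1) = y at *
  have h5 : 1 / y < 1 := by rw [div_lt_one (by linarith)]; exact hy
  have h6 : 1 / 3 < 1 / (2 + 1 / y) := by
    have : 0 < 1 / y := by positivity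
    apply one_div_lt_one_div_of_lt <;> linarith
  have h7 : 0 < 1 / x := by positivity
  have h8 : 1 / (2 + 1 / x) < 1 / 2 := by
    apply one_div_lt_one_div_of_lt <;> linarith
  have h9 : 1 / (3 / 2) < 1 / (1 + 1 / (2 + 1 / x)) := by
    have : 0 < 1 / (2 + 1 / x) := by positivity
    apply one_div_lt_one_div_of_lt <;> linarith
  push_cast at hk
  norm_num at *
  linarith

/-- Since `[2; 1, 1, x] + [0; 2, x] = 3`, around `22|11` the left side is at most the
right side. -/
theorem IsMarkov.leftVal_le_rightVal (h : IsMarkov ω) (k : ℤ) (h0 : ω (k - 1) = 2)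
    (h1 : ω k = 2) (h2 : ω (k + 1) = 1) : leftVal ω (k - 2) ≤ rightVal ω (k + 3) := by
  have h3 := h.not_212 k h1 h2
  have hk := h.2 k
  rw [rightVal_eq h.1, rightVal_eq h.1 (k + 1 + 1), leftVal_eq h.1, add_assoc k 1 1,
    one_add_one_eq_two, h1, h2, h3, h0, sub_sub, add_assoc, one_add_one_eq_two, add_assoc k 2 1,
    show (2 : ℤ) + 1 = 3 by rfl] at hk
  have hx := one_lt_rightVal h.1 (k + 3)
  have hy := one_lt_leftVal h.1 (k - 2)
  generalize rightVal ω (k + 3) = x at *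
  generalize leftVal ω (k - 2) = y at *
  have e1 : 1 / (1 + 1 / (1 + 1 / x)) = 1 - x / (2 * x + 1) := by
    have : 2 * x + 1 ≠ 0 := by positivity
    have : x + 1 ≠ 0 := by positivity
    have : x + 1 + x ≠ 0 := by positivity
    field_simp
    ring
  have e2 : 1 / (2 + 1 / y) = y / (2 * y + 1) := by field_simp
  push_cast at hk
  rw [e1, e2] at hk
  have : y / (2 * y + 1) ≤ x / (2 * x + 1) := by linarith
  rw [div_le_div_iff₀ (by positivity) (by positivity)] at this
  linarith

theorem IsMarkov.rightVal_le_leftVal (h : IsMarkov ω) (k : ℤ) (h0 : ω (k + 1) = 2)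
    (h1 : ω k = 2) (h2 : ω (k - 1) = 1) : rightVal ω (k + 2) ≤ leftVal ω (k - 3) := by
  have := h.reverse.leftVal_le_rightVal (-k) (by simpa [add_comm] using h0) (by simpa using h1)
    (by rw [← h2]; congr 1; ring)
  unfold rightVal leftVal at *
  convert this using 4 <;> ring

/-- Two places where the digit changes are an even distance apart. -/
theorem IsMarkov.even_of_change (h : IsMarkov ω) (l : ℕ) (p : ℤ) (hl : 0 < l)
    (hp : ω p ≠ ω (p + 1)) (hq : ω (p + l) ≠ ω (p + l + 1)) : Even l := by
  induction l using Nat.strong_induction_on generalizing p with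
  | _ l ih =>
  by_contra hodd
  rw [Nat.not_even_iff_odd] at hodd
  have hnc : ∀ i : ℕ, 0 < i → i < l → ω (p + i) = ω (p + i + 1) := by
    intro i hi hil
    by_contra hne
    have e1 := ih i hil p hi hp hne
    have e2 := ih (l - i) (by omega) (p + i) (by omega) hne
      (by rw [Nat.cast_sub hil.le]; simpa using hq)
    apply Nat.not_even_iff_odd.2 hodd
    have := e1.add e2
    rwa [Nat.add_sub_cancel' hil.le] at this
  have hrun : ∀ i : ℕ, i < l → ω (p + 1 + i) = ω (p + 1) := by
    intro i
    induction i with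
    | zero => simp
    | succ i ihi =>
      intro hi
      rw [← ihi (by omega), show p + 1 + (i : ℤ) = p + (i + 1 : ℕ) by push_cast; ring,
        hnc (i + 1) (by omega) hi]
      congr 1
      push_cast
      ring
  have hlast := hrun (l - 1) (by omega)
  rw [show p + 1 + ((l - 1 : ℕ) : ℤ) = p + l by rw [Nat.cast_sub hl]; push_cast; ring] at hlast
  rcases h.eq_one_or_two (p + 1) with h1 | h1
  · have hp2 : ω p = 2 := by have := h.eq_one_or_two p; omega
    have hq2 : ω (p + l + 1) = 2 := by have := h.eq_one_or_two (p + l + 1); omega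
    have hl3 : 3 ≤ l := by
      by_contra hlt
      have : l = 1 := by rcases hodd with ⟨k, rfl⟩; omega
      subst this
      have := h.not_212 p hp2 h1
      rw [show p + ((1 : ℕ) : ℤ) + 1 = p + 2 by push_cast; ring] at hq2
      omega
    have hpm := h.not_121 p hp2 h1
    have hle := h.leftVal_le_rightVal p hpm hp2 h1
    refine hle.not_gt ((cfVal_odd_run (x := 1) (y := 2) (m := l - 2) (fun _ => h.1 _)
      (fun _ => h.1 _) (fun _ => h.eq_one_or_two _) ?_ ?_ ?_ ?_).1 (by norm_num))
    · rcases hodd with ⟨k, rfl⟩; exact ⟨k - 1, by omega⟩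
    · intro i hi
      rw [← h1, ← hrun (i + 2) (by omega)]
      congr 1; push_cast; ring
    · refine Eq.trans ?_ hq2
      rw [Nat.cast_sub (by omega)]
      congr 1; push_cast; ring
    · intro n hn hno hg hgn
      refine Nat.not_even_iff_odd.2 hno (ih n (by omega) (p - 2 - n) hno.pos ?_ ?_)
      · have := hg (n - 1) (by have := hno.pos; omega)
        rw [Nat.cast_sub hno.pos] at this
        rw [hgn, show p - 2 - (n : ℤ) + 1 = p - 2 - (n - (1 : ℕ)) by push_cast; ring, this]
        norm_num
      · have := hg 0 hno.pos
        rw [show p - 2 - (n : ℤ) + n = p - 2 - (0 : ℕ) by push_cast; ring, this,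
          show p - 2 - ((0 : ℕ) : ℤ) + 1 = p - 1 by push_cast; ring, hpm]
        norm_num
  · have hp2 : ω p = 1 := by have := h.eq_one_or_two p; omega
    have hq2 : ω (p + l + 1) = 1 := by have := h.eq_one_or_two (p + l + 1); omega
    rw [h1] at hlast
    have hqm := h.not_121 _ hlast hq2
    have hqp := h.not_212 _ hlast hq2
    have hl3 : 3 ≤ l := by
      by_contra hlt
      have : l = 1 := by rcases hodd with ⟨k, rfl⟩; omega
      subst this
      rw [show p + ((1 : ℕ) : ℤ) - 1 = p by push_cast; ring] at hqm
      omega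
    have hle := h.leftVal_le_rightVal _ hqm hlast hq2
    refine hle.not_gt ((cfVal_odd_run (x := 2) (y := 1) (m := l - 2) (fun _ => h.1 _)
      (fun _ => h.1 _) (fun _ => (h.eq_one_or_two _).symm) ?_ ?_ ?_ ?_).2 (by norm_num))
    · rcases hodd with ⟨k, rfl⟩; exact ⟨k - 1, by omega⟩
    · intro i hi
      rw [← h1, ← hrun (l - 3 - i) (by omega), Nat.cast_sub (by omega), Nat.cast_sub (by omega)]
      congr 1; push_cast; ring
    · rw [← hp2, Nat.cast_sub (by omega)]
      congr 1; push_cast; ring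
    · intro n hn hno hg hgn
      refine Nat.not_even_iff_odd.2 hno (ih n (by omega) (p + l + 2) hno.pos ?_ ?_)
      · have := hg 0 hno.pos
        rw [hqp, show p + (l : ℤ) + 2 + 1 = p + l + 3 + (0 : ℕ) by push_cast; ring, this]
        norm_num
      · have := hg (n - 1) (by have := hno.pos; omega)
        rw [Nat.cast_sub hno.pos] at this
        rw [show p + (l : ℤ) + 2 + n = p + l + 3 + (n - (1 : ℕ)) by push_cast; ring, this,
          show p + (l : ℤ) + 3 + (n - ((1 : ℕ) : ℤ)) + 1 = p + l + 3 + n by push_cast; ring, hgn]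
        norm_num

theorem IsMarkov.exists_pairing (h : IsMarkov ω) :
    ∃ e : ℤ, ∀ i, ω (e + 2 * i) = ω (e + 2 * i + 1) := by
  by_cases hc : ∃ p, ω p ≠ ω (p + 1)
  · obtain ⟨p, hp⟩ := hc
    refine ⟨p + 1, fun i => ?_⟩
    by_contra hne
    rcases lt_or_ge i 0 with hi | hi
    · obtain ⟨n, rfl⟩ : ∃ n : ℕ, i = -(n + 1) := ⟨(-i - 1).toNat, by omega⟩
      have := h.even_of_change (2 * n + 1) _ (by omega) hne
        (by convert hp using 2 <;> (congr 1; push_cast; ring))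
      exact absurd this (by simp)
    · lift i to ℕ using hi
      have := h.even_of_change (2 * i + 1) p (by omega) hp
        (by rwa [show p + ((2 * i + 1 : ℕ) : ℤ) = p + 1 + 2 * i by push_cast; ring])
      exact absurd this (by simp)
  · push Not at hc
    exact ⟨0, fun i => hc _⟩

end

/-! ### Markov's combinatorial condition implies balance -/

/-- No factor `0 m̃ 0 1 m 1`, where `m̃` is the reversal of `m`. -/
def AvoidsSkew (s : ℤ → ℤ) : Prop :=
  ∀ (c : ℤ) (r : ℕ), s c = 0 → s (c + 1) = 1 → (∀ q < r, s (c - 1 - q) = s (c + 2 + q)) →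
    s (c - 1 - r) = 0 → s (c + 2 + r) ≠ 1

/-- The coding of a Markov sequence by `11 ↦ 0`, `22 ↦ 1`. -/
theorem IsMarkov.exists_coding {ω : ℤ → ℕ} (h : IsMarkov ω) :
    ∃ (e : ℤ) (s : ℤ → ℤ), (∀ i, s i = 0 ∨ s i = 1) ∧
      (∀ i, (ω (e + 2 * i) : ℤ) = 1 + s i ∧ (ω (e + 2 * i + 1) : ℤ) = 1 + s i) ∧
      AvoidsSkew s ∧ AvoidsSkew fun i => 1 - s i := by
  obtain ⟨e, he⟩ := h.exists_pairing
  set s : ℤ → ℤ := fun i => ω (e + 2 * i) - 1 with hs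
  have h1 : ∀ i, (ω (e + 2 * i) : ℤ) = 1 + s i ∧ (ω (e + 2 * i + 1) : ℤ) = 1 + s i := fun i =>
    ⟨by simp [hs], by simp [hs, he i]⟩
  have h01 : ∀ i, s i = 0 ∨ s i = 1 := fun i => by
    rcases h.eq_one_or_two (e + 2 * i) with h | h <;> simp [hs, h]
  have agree : ∀ (c : ℤ) (r : ℕ), (∀ q < r, s (c - 1 - q) = s (c + 2 + q)) → ∀ i < 2 * r,
      ω (e + 2 * c - 1 - i) = ω (e + 2 * c + 4 + i) := by
    intro c r hq i hi
    have hq := hq (i / 2) (by omega)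
    have a1 := h1 (c - 1 - (i / 2 : ℕ))
    have a2 := h1 (c + 2 + (i / 2 : ℕ))
    rcases Nat.even_or_odd' i with ⟨k, rfl | rfl⟩
    · rw [show 2 * k / 2 = k by omega] at *
      rw [show e + 2 * c - 1 - ((2 * k : ℕ) : ℤ) = e + 2 * (c - 1 - k) + 1 by push_cast; ring,
        show e + 2 * c + 4 + ((2 * k : ℕ) : ℤ) = e + 2 * (c + 2 + k) by push_cast; ring]
      omega
    · rw [show (2 * k + 1) / 2 = k by omega] at *
      rw [show e + 2 * c - 1 - ((2 * k + 1 : ℕ) : ℤ) = e + 2 * (c - 1 - k) by push_cast; ring,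
        show e + 2 * c + 4 + ((2 * k + 1 : ℕ) : ℤ) = e + 2 * (c + 2 + k) + 1 by push_cast; ring]
      omega
  have left : ∀ (c : ℤ) (r : ℕ), (ω (e + 2 * c - 1 - (2 * r : ℕ)) : ℤ) = 1 + s (c - 1 - r) := by
    intro c r
    rw [← (h1 (c - 1 - r)).2]
    congr 2; push_cast; ring
  have right : ∀ (c : ℤ) (r : ℕ), (ω (e + 2 * c + 4 + (2 * r : ℕ)) : ℤ) = 1 + s (c + 2 + r) := by
    intro c r
    rw [← (h1 (c + 2 + r)).1]
    congr 2; push_cast; ring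
  refine ⟨e, s, h01, h1, ?_, ?_⟩
  · intro c r h0 h1' hq hl hr
    have a0 := h1 c
    have a1 := h1 (c + 1)
    have hle := h.rightVal_le_leftVal (e + 2 * (c + 1)) (by omega) (by omega)
      (by rw [show e + 2 * (c + 1) - 1 = e + 2 * c + 1 by ring]; omega)
    rw [show e + 2 * (c + 1) + 2 = e + 2 * c + 4 by ring,
      show e + 2 * (c + 1) - 3 = e + 2 * c - 1 by ring] at hle
    refine hle.not_gt ((cfVal_lex (2 * r) (fun _ => h.1 _) (fun _ => h.1 _)
      (agree c r hq) ?_).1 (even_two_mul r))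
    have := left c r
    have := right c r
    omega
  · intro c r h0 h1' hq hl hr
    simp only at h0 h1' hq hl hr
    have a0 := h1 c
    have a1 := h1 (c + 1)
    have hle := h.leftVal_le_rightVal (e + 2 * c + 1) (by simp only [add_sub_cancel_right]; omega)
      (by omega) (by rw [show e + 2 * c + 1 + 1 = e + 2 * (c + 1) by ring]; omega)
    rw [show e + 2 * c + 1 + 3 = e + 2 * c + 4 by ring,
      show e + 2 * c + 1 - 2 = e + 2 * c - 1 by ring] at hle
    refine hle.not_gt ((cfVal_lex (2 * r) (fun _ => h.1 _) (fun _ => h.1 _)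
      (fun i hi => (agree c r (fun q hq' => by have := hq q hq'; omega) i hi).symm) ?_).1
      (even_two_mul r))
    have := left c r
    have := right c r
    omega

theorem exists_primitive (s : ℤ → ℤ) : ∃ S : ℤ → ℤ, ∀ i, S (i + 1) = S i + s i := by
  refine ⟨fun z => ∑ k ∈ Finset.range z.toNat, s k - ∑ k ∈ Finset.range (-z).toNat, s (-1 - k),
    fun z => ?_⟩
  rcases lt_or_ge z 0 with hz | hz
  · obtain ⟨n, rfl⟩ : ∃ n : ℕ, z = -1 - n := ⟨(-z - 1).toNat, by omega⟩
    have e1 : (-1 - (n : ℤ)).toNat = 0 := by omega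
    have e2 : (-1 - (n : ℤ) + 1).toNat = 0 := by omega
    have e3 : (-(-1 - (n : ℤ))).toNat = n + 1 := by omega
    have e4 : (-(-1 - (n : ℤ) + 1)).toNat = n := by omega
    simp only [e1, e2, e3, e4, Finset.sum_range_succ]
    simp
  · lift z to ℕ using hz
    have e1 : ((z : ℤ) + 1).toNat = z + 1 := by omega
    have e2 : (-((z : ℤ) + 1)).toNat = 0 := by omega
    have e3 : (-(z : ℤ)).toNat = 0 := by omega
    simp only [e1, e2, e3, Int.toNat_natCast, Finset.sum_range_succ]
    simp

/-- A primitive of a `0`-`1` sequence is balanced if any two windows of the same length have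
sums differing by at most one. -/
def IsBalancedPrimitive (S : ℤ → ℤ) : Prop :=
  ∀ (h : ℕ) (i j : ℤ), S (j + h) - S j - (S (i + h) - S i) ≤ 1

theorem reflect_sum {s S : ℤ → ℤ} (hS : ∀ i, S (i + 1) = S i + s i) (c : ℤ) (r : ℕ)
    (hq : ∀ q < r, s (c - 1 - q) = s (c + 2 + q)) :
    S c - S (c - r) = S (c + 2 + r) - S (c + 2) := by
  induction r with
  | zero => simp
  | succ r ih =>
    have h1 := ih fun q hq' => hq q (by omega)
    have h2 := hq r (by omega)
    have h3 := hS (c - 1 - r)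
    have h4 := hS (c + 2 + r)
    rw [show c - 1 - (r : ℤ) + 1 = c - r by ring] at h3
    push_cast
    rw [show c - ((r : ℤ) + 1) = c - 1 - r by ring,
      show c + 2 + ((r : ℤ) + 1) = c + 2 + r + 1 by ring]
    linarith

/-- In a sequence avoiding `0 m̃ 0 1 m 1`, a window that is too light cannot be followed by one
that is too heavy, if all shorter or closer pairs of windows are balanced. -/
theorem no_minimal_unbalanced {s S : ℤ → ℤ} (hS : ∀ i, S (i + 1) = S i + s i)
    (h01 : ∀ i, s i = 0 ∨ s i = 1) (hs : AvoidsSkew s) (h : ℕ) (d : ℕ) (i : ℤ)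
    (hmin : ∀ l < h, ∀ i j : ℤ, S (j + l) - S j - (S (i + l) - S i) ≤ 1)
    (dmin : ∀ i j : ℤ, |j - i| < d → S (j + h) - S j - (S (i + h) - S i) ≤ 1) :
    S (i + d + h) - S (i + d) - (S (i + h) - S i) ≤ 1 := by
  by_contra hcon
  push Not at hcon
  obtain ⟨j, hj⟩ : ∃ j, j = i + d := ⟨_, rfl⟩
  rw [← hj] at hcon
  have hd0 : 0 < d := by
    rcases Nat.eq_zero_or_pos d with rfl | h
    · simp at hj; subst hj; omega
    · exact h
  have hh2 : 2 ≤ h := by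
    by_contra hlt
    obtain rfl | rfl : h = 0 ∨ h = 1 := by omega
    · simp at hcon
    · have := hS i; have := hS j; have := h01 i; have := h01 j
      push_cast at hcon
      omega
  have hnon : h ≤ d := by
    by_contra hlt
    have := hmin d (by omega) i (i + h)
    rw [show i + h + d = j + h by omega, ← hj] at this
    omega
  have hmid : ∀ t : ℤ, i < t → t < j → S (t + h) - S t = S (i + h) - S i + 1 ∧
      S (j + h) - S j = S (i + h) - S i + 2 := by
    intro t h1 h2
    have := dmin i t (by rw [abs_lt]; omega)
    have := dmin t j (by rw [abs_lt]; omega)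
    omega
  have hF := hmid (i + 1) (by omega) (by omega)
  have hpre : ∀ l : ℕ, 0 < l → l < h → S (j + l) - S j = S (i + l) - S i + 1 := by
    intro l h1 h2
    have := hmin l h2 i j
    have a := hmin (h - l) (by omega) (i + l) (j + l)
    rw [Nat.cast_sub h2.le, show j + l + ((h : ℤ) - l) = j + h by ring,
      show i + l + ((h : ℤ) - l) = i + h by ring] at a
    omega
  obtain ⟨c, hc⟩ : ∃ c, c = i + h - 1 := ⟨_, rfl⟩
  have si : s i = 0 := by
    have := hpre 1 (by omega) (by omega)
    push_cast at this
    rw [hS, hS] at this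
    have := h01 i; have := h01 j
    omega
  have hlast := hpre (h - 1) (by omega) (by omega)
  rw [Nat.cast_sub (by omega), show i + ((h : ℤ) - (1 : ℕ)) = c by push_cast; omega] at hlast
  have hSc := hS c
  have hSj := hS (j + ((h : ℤ) - (1 : ℕ)))
  have hj1 := h01 (j + ((h : ℤ) - (1 : ℕ)))
  rw [show j + ((h : ℤ) - (1 : ℕ)) + 1 = j + h by push_cast; omega] at hSj
  rw [show c + 1 = i + h by omega] at hSc
  have hc1 := h01 c
  have sc : s c = 0 := by omega
  have sj : s (j + h - 1) = 1 := by
    rw [show j + h - 1 = j + ((h : ℤ) - (1 : ℕ)) by push_cast; omega]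
    omega
  have sc1 : s (c + 1) = 1 := by
    have a := hS i
    have b := hS (c + 1)
    rw [show c + 1 = i + h by omega] at *
    rw [show i + h + 1 = i + 1 + h by ring] at b
    omega
  have hc2 : S (c + 2) = S c + 1 := by
    have := hS (c + 1)
    rw [show c + 1 + 1 = c + 2 by ring, show c + 1 = i + h by omega] at this
    rw [show c + 1 = i + h by omega] at sc1
    omega
  have hrefl : ∀ r : ℕ, (r : ℤ) ≤ j - i - 2 → s (c - 1 - r) = s (c + 2 + r) := by
    intro r
    induction r using Nat.strong_induction_on with
    | _ r ih =>
    intro hr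
    have hq : ∀ q < r, s (c - 1 - q) = s (c + 2 + q) := fun q hq => ih q hq (by omega)
    by_contra hne
    have hskew := hs c r sc sc1 hq
    have b1 := h01 (c - 1 - r)
    have b2 := h01 (c + 2 + r)
    have s1 : s (c - 1 - r) = 1 := by omega
    have s2 : s (c + 2 + r) = 0 := by omega
    have hr' : (r : ℤ) < j - i - 2 := by
      refine lt_of_le_of_ne hr fun he => ?_
      rw [show c + 2 + (r : ℤ) = j + h - 1 by omega] at s2
      omega
    have E := reflect_sum hS c r hq
    have g1 := hS (c - 1 - r)
    have g2 := hS (c + 2 + r)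
    rw [show c - 1 - (r : ℤ) + 1 = c - r by ring] at g1
    rw [show c + 2 + (r : ℤ) + 1 = c + 3 + r by ring] at g2
    rcases lt_trichotomy (r + 2) h with hlt | heq | hgt
    · have k1 := hpre (h - (r + 2)) (by omega) (by omega)
      have k2 := (hmid (i + (r + 2 : ℕ)) (by omega) (by omega)).1
      have k3 := hmin (r + 2) hlt i (j + (h - (r + 2) : ℕ))
      rw [Nat.cast_sub (by omega)] at k1 k3
      rw [show i + ((h : ℤ) - (r + 2 : ℕ)) = c - 1 - r by push_cast; omega] at k1
      rw [show i + ((r + 2 : ℕ) : ℤ) + h = c + 3 + r by push_cast; omega] at k2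
      rw [show j + ((h : ℤ) - (r + 2 : ℕ)) + (r + 2 : ℕ) = j + h by ring] at k3
      omega
    · have k := (hmid (i + h) (by omega) (by omega)).1
      rw [show i + (h : ℤ) + h = c + 3 + r by omega] at k
      rw [show c - 1 - (r : ℤ) = i by omega] at g1 s1
      omega
    · have E' := reflect_sum hS c (r + 1 - h) fun q hq' => hq q (by omega)
      have k1 := (hmid (i + r + 2) (by omega) (by omega)).1
      have k2 := dmin i (c - 1 - r) (by rw [abs_lt]; omega)
      rw [Nat.cast_sub (by omega)] at E'
      rw [show c - (((r + 1 : ℕ) : ℤ) - h) = c - 1 - r + h by push_cast; ring,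
        show c + 2 + (((r + 1 : ℕ) : ℤ) - h) = i + r + 2 by push_cast; omega] at E'
      rw [show i + r + 2 + (h : ℤ) = c + 3 + r by omega] at k1
      omega
  have E := reflect_sum hS c (d - 1) fun q hq => hrefl q (by omega)
  rw [Nat.cast_sub (by omega)] at E
  rw [show c + 2 + ((d : ℤ) - (1 : ℕ)) = j + h by push_cast; omega] at E
  rcases hnon.eq_or_lt with heq | hlt
  · rw [show c - ((d : ℤ) - (1 : ℕ)) = i by push_cast; omega] at E
    rw [show j = i + h by omega] at *
    omega
  · have E' := reflect_sum hS c (d - 1 - h) fun q hq => hrefl q (by omega)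
    have k := dmin i (c - ((d : ℤ) - (1 : ℕ))) (by rw [abs_lt]; push_cast; omega)
    rw [Nat.cast_sub (by omega), Nat.cast_sub (by omega)] at E'
    rw [show c - ((d : ℤ) - (1 : ℕ) - h) = c - ((d : ℤ) - (1 : ℕ)) + h by ring,
      show c + 2 + ((d : ℤ) - (1 : ℕ) - h) = j by push_cast; omega] at E'
    omega

theorem balanced_of_avoidsSkew {s S : ℤ → ℤ} (hS : ∀ i, S (i + 1) = S i + s i)
    (h01 : ∀ i, s i = 0 ∨ s i = 1) (hs : AvoidsSkew s) (hs' : AvoidsSkew fun i => 1 - s i) :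
    IsBalancedPrimitive S := by
  intro h
  induction h using Nat.strong_induction_on with
  | _ h hmin =>
  suffices H : ∀ (d : ℕ) (i j : ℤ), |j - i| = d → S (j + h) - S j - (S (i + h) - S i) ≤ 1 from
    fun i j => H (j - i).natAbs i j (by simp)
  intro d
  induction d using Nat.strong_induction_on with
  | _ d dmin =>
  intro i j hij
  have dmin' : ∀ i j : ℤ, |j - i| < d → S (j + h) - S j - (S (i + h) - S i) ≤ 1 :=
    fun i j hlt => dmin (j - i).natAbs (by rw [Int.abs_eq_natAbs] at hlt; omega) i j (by simp)
  rcases le_total i j with hle | hle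
  · obtain rfl : j = i + d := by rw [abs_of_nonneg (by omega)] at hij; omega
    exact no_minimal_unbalanced hS h01 hs h d i hmin dmin'
  · obtain rfl : i = j + d := by rw [abs_of_nonpos (by omega)] at hij; omega
    have := no_minimal_unbalanced (S := fun i => i - S i) (s := fun i => 1 - s i)
      (fun i => by have := hS i; omega) (fun i => by have := h01 i; omega) hs' h d j
      (fun l hl i j => by have := hmin l hl j i; omega)
      (fun i j hlt => by have := dmin' j i (by rwa [abs_sub_comm]); omega)
    omega

/-! ### Counting windows of balanced sequences -/

theorem IsBalancedPrimitive.slope_lt {S : ℤ → ℤ} (hb : IsBalancedPrimitive S) (n : ℕ) (h l : ℕ) (hn : h + l ≤ n)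
    (hh : 0 < h) (hl : 0 < l) (i j : ℤ) :
    (l : ℤ) * (S (i + h) - S i - 1) < h * (S (j + l) - S j + 1) := by
  induction n generalizing h l i j with
  | zero => omega
  | succ n ih =>
    rcases lt_trichotomy h l with hlt | rfl | hlt
    · obtain ⟨k, rfl⟩ := Nat.exists_eq_add_of_lt hlt
      have h1 := ih h (k + 1) (by omega) hh (by omega) i j
      have h2 := hb h (j + (k + 1 : ℕ)) i
      push_cast at *
      rw [show j + (k + 1) + (h : ℤ) = j + (h + k + 1) by ring] at h2
      have hh' : (0 : ℤ) < h := by exact_mod_cast hh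
      nlinarith
    · have := hb h j i
      have hh' : (0 : ℤ) < h := by exact_mod_cast hh
      nlinarith
    · obtain ⟨k, rfl⟩ := Nat.exists_eq_add_of_lt hlt
      have h1 := ih (k + 1) l (by omega) (by omega) hl i j
      have h2 := hb l j (i + (k + 1 : ℕ))
      push_cast at *
      rw [show i + (k + 1) + (l : ℤ) = i + (l + k + 1) by ring] at h2
      have hh' : (0 : ℤ) < l := by exact_mod_cast hl
      nlinarith

theorem sub_bounds {s S : ℤ → ℤ} (hS : ∀ i, S (i + 1) = S i + s i)
    (h01 : ∀ i, s i = 0 ∨ s i = 1) (i : ℤ) (h : ℕ) : 0 ≤ S (i + h) - S i ∧ S (i + h) - S i ≤ h := by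
  induction h with
  | zero => simp
  | succ h ih =>
    have := hS (i + h)
    have := h01 (i + h)
    push_cast
    rw [← add_assoc]
    omega

/-- A window of length `m` of a balanced sequence is a discretised line of rational slope with
denominator at most `2m`. -/
theorem IsBalancedPrimitive.exists_line {s S : ℤ → ℤ} (hS : ∀ i, S (i + 1) = S i + s i)
    (h01 : ∀ i, s i = 0 ∨ s i = 1) (hb : IsBalancedPrimitive S) (t : ℤ) (m : ℕ) (hm : 0 < m) :
    ∃ P Q r : ℕ, P ≤ Q ∧ Q ≤ 2 * m ∧ r < Q ∧
      ∀ q ≤ m, S (t + q) - S t = ((P : ℤ) * q - r + Q - 1) / Q := by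
  classical
  let T := ((Finset.range (m + 1)) ×ˢ (Finset.range (m + 1))).filter fun x => x.1 < x.2
  have hT : T.Nonempty := ⟨(0, 1), by simp [T]; omega⟩
  obtain ⟨⟨i₁, j₁⟩, hx₁, hmax⟩ := T.exists_max_image
    (fun x => ((S (t + x.2) - S (t + x.1) - 1 : ℤ) : ℚ) / ((x.2 : ℚ) - x.1)) hT
  obtain ⟨⟨i₂, j₂⟩, hx₂, hmin⟩ := T.exists_min_image
    (fun x => ((S (t + x.2) - S (t + x.1) + 1 : ℤ) : ℚ) / ((x.2 : ℚ) - x.1)) hT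
  simp only [T, Finset.mem_filter, Finset.mem_product, Finset.mem_range] at hx₁ hx₂ hmax hmin
  obtain ⟨h₁, e₁⟩ : ∃ h₁ : ℕ, j₁ = i₁ + h₁ := ⟨j₁ - i₁, by omega⟩
  obtain ⟨h₂, e₂⟩ : ∃ h₂ : ℕ, j₂ = i₂ + h₂ := ⟨j₂ - i₂, by omega⟩
  subst e₁ e₂
  have hlt := hb.slope_lt _ h₁ h₂ le_rfl (by omega) (by omega) (t + i₁) (t + i₂)
  have bd₁ := sub_bounds hS h01 (t + i₁) h₁
  have bd₂ := sub_bounds hS h01 (t + i₂) h₂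
  obtain ⟨P, hP⟩ : ∃ P : ℕ, (P : ℤ) = (S (t + i₁ + h₁) - S (t + i₁) - 1) +
      (S (t + i₂ + h₂) - S (t + i₂) + 1) := ⟨_, Int.toNat_of_nonneg (by omega)⟩
  have hclose : ∀ i j : ℕ, i < j → j ≤ m →
      |((h₁ + h₂ : ℕ) : ℤ) * (S (t + j) - S (t + i)) - P * (j - i)| < (h₁ + h₂ : ℕ) := by
    intro i j hij hjm
    have a := hmax (i, j) ⟨⟨by omega, by omega⟩, hij⟩
    have b := hmin (i, j) ⟨⟨by omega, by omega⟩, hij⟩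
    simp only [Nat.cast_add, add_sub_cancel_left] at a b
    have p0 : (0 : ℚ) < (j : ℚ) - i := by
      have : (i : ℚ) < j := by exact_mod_cast hij
      linarith
    have p1 : (0 : ℚ) < h₁ := by exact_mod_cast (by omega : 0 < h₁)
    have p2 : (0 : ℚ) < h₂ := by exact_mod_cast (by omega : 0 < h₂)
    rw [div_le_div_iff₀ p0 p1] at a
    rw [div_le_div_iff₀ p2 p0] at b
    have a' : (S (t + j) - S (t + i) - 1) * (h₁ : ℤ) ≤
        (S (t + (i₁ + h₁)) - S (t + i₁) - 1) * ((j : ℤ) - i) := by exact_mod_cast a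
    have b' : (S (t + (i₂ + h₂)) - S (t + i₂) + 1) * ((j : ℤ) - i) ≤
        (S (t + j) - S (t + i) + 1) * (h₂ : ℤ) := by exact_mod_cast b
    have q0 : (0 : ℤ) < (j : ℤ) - i := by omega
    have q1 : (0 : ℤ) < h₁ := by omega
    have q2 : (0 : ℤ) < h₂ := by omega
    rw [← add_assoc] at a' b'
    rw [hP]
    generalize S (t + i₁ + h₁) - S (t + i₁) - 1 = A at *
    generalize S (t + i₂ + h₂) - S (t + i₂) + 1 = B at *
    generalize S (t + j) - S (t + i) = D at *
    generalize (j : ℤ) - i = k at *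
    push_cast
    have u1 : (D - 1) * h₂ < B * k := by
      have : ((D - 1) * h₂) * h₁ < (B * k) * h₁ := by nlinarith
      exact lt_of_mul_lt_mul_right this q1.le
    have u2 : A * k < (D + 1) * h₁ := by
      have : (A * k) * h₂ < ((D + 1) * h₁) * h₂ := by nlinarith
      exact lt_of_mul_lt_mul_right this q2.le
    rw [abs_lt]
    constructor <;> nlinarith
  obtain ⟨k, hk, hkmin⟩ := (Finset.range (m + 1)).exists_min_image
    (fun q : ℕ => ((h₁ + h₂ : ℕ) : ℤ) * (S (t + q) - S t) - P * q) ⟨0, by simp⟩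
  simp only [Finset.mem_range] at hk hkmin
  have hk0 := hkmin 0 (by omega)
  simp only [Nat.cast_zero, add_zero, sub_self, mul_zero] at hk0
  obtain ⟨r, hr⟩ : ∃ r : ℕ, (r : ℤ) = -(((h₁ + h₂ : ℕ) : ℤ) * (S (t + k) - S t) - P * k) :=
    ⟨_, Int.toNat_of_nonneg (by omega)⟩
  have hspread : ∀ q ≤ m, (((h₁ + h₂ : ℕ) : ℤ) * (S (t + q) - S t) - P * q) + r
      < (h₁ + h₂ : ℕ) := by
    intro q hq
    rcases lt_trichotomy q k with hlt | rfl | hlt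
    · have := (abs_lt.1 (hclose q k hlt (by omega))).1
      rw [hr]
      linarith
    · rw [hr]; omega
    · have := (abs_lt.1 (hclose k q hlt hq)).2
      rw [hr]
      linarith
  refine ⟨P, h₁ + h₂, r, ?_, by omega, ?_, ?_⟩
  · omega
  · have := hspread 0 (by omega)
    simp at this
    omega
  · intro q hq
    have a := hspread q hq
    have b := hkmin q (by omega)
    have hpos : (0 : ℤ) < (h₁ + h₂ : ℕ) := by omega
    symm
    rw [Int.ediv_eq_iff_of_pos hpos]
    constructor <;> linarith

/-- The word over `{1, 2}` read off, with offset `x.1`, from the discretised line with slope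
`x.2.1 / (x.2.2.1 + 1)` and intercept given by `x.2.2.2`. -/
def lineWord (n : ℕ) (x : ℕ × ℕ × ℕ × ℕ) (i : Fin n) : ℕ :=
  let c : ℕ → ℤ := fun q => ((x.2.1 : ℤ) * q - x.2.2.2 + x.2.2.1) / (x.2.2.1 + 1)
  (1 + (c ((x.1 + i) / 2 + 1) - c ((x.1 + i) / 2))).toNat

theorem IsMarkov.exists_lineWord {ω : ℤ → ℕ} (h : IsMarkov ω) (n m : ℕ) (hm : m = n / 2 + 1)
    (k : ℤ) : ∃ x ∈ Finset.range 2 ×ˢ Finset.range (2 * m + 1) ×ˢ Finset.range (2 * m) ×ˢ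
      Finset.range (2 * m), lineWord n x = fun i : Fin n => ω (k + (i : ℕ)) := by
  obtain ⟨e, s, h01, hω, hs, hs'⟩ := h.exists_coding
  obtain ⟨S, hS⟩ := exists_primitive s
  have hb := balanced_of_avoidsSkew hS h01 hs hs'
  obtain ⟨t, δ, hδ, hk⟩ : ∃ (t : ℤ) (δ : ℕ), δ < 2 ∧ k = e + 2 * t + δ :=
    ⟨(k - e) / 2, ((k - e) % 2).toNat, by omega, by omega⟩
  obtain ⟨P, Q, r, hPQ, hQ, hr, hline⟩ := hb.exists_line hS h01 t m (by omega)
  refine ⟨(δ, P, Q - 1, r), ?_, ?_⟩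
  · simp only [Finset.mem_product, Finset.mem_range]
    omega
  · funext i
    have hi := i.2
    obtain ⟨q, hq⟩ : ∃ q, q = (δ + (i : ℕ)) / 2 := ⟨_, rfl⟩
    have a := hline q (by omega)
    have b := hline (q + 1) (by omega)
    have hQ1 : ((Q - 1 : ℕ) : ℤ) = Q - 1 := by omega
    simp only [lineWord, ← hq, hQ1, sub_add_cancel, ← add_sub_assoc, ← a, ← b]
    have c := hS (t + q)
    have w := hω (t + q)
    have : (ω (k + (i : ℕ)) : ℤ) = 1 + s (t + q) := by
      rcases (by omega : δ + (i : ℕ) = 2 * q ∨ δ + (i : ℕ) = 2 * q + 1) with hq' | hq'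
      · rw [show k + ((i : ℕ) : ℤ) = e + 2 * (t + q) by omega]; exact w.1
      · rw [show k + ((i : ℕ) : ℤ) = e + 2 * (t + q) + 1 by omega]; exact w.2
    push_cast
    rw [← add_assoc]
    omega

/-- The number of length-`n` factors of bi-infinite sequences of positive
integers whose Markov value is at most `3` is at most `9 n³`. -/
theorem card_Sigma3_le (n : ℕ) (hn : 1 ≤ n) :
    Nat.card {w : Fin n → ℕ // ∃ ω : ℤ → ℕ, (∀ i, 0 < ω i) ∧
        (∀ k : ℤ, lam (fun i => ω (i + k)) ≤ 3) ∧
        ∃ k : ℤ, ∀ i : Fin n, w i = ω (k + (i : ℤ))} ≤ 9 * n ^ 3 := by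
  classical
  suffices H : ∃ F : Finset (Fin n → ℕ), F.card ≤ 9 * n ^ 3 ∧
      ∀ (ω : ℤ → ℕ) (k : ℤ), IsMarkov ω → (fun i : Fin n => ω (k + (i : ℕ))) ∈ F by
    obtain ⟨F, hF, hmem⟩ := H
    refine le_trans ?_ hF
    have hsub : ∀ w : Fin n → ℕ, (∃ ω : ℤ → ℕ, (∀ i, 0 < ω i) ∧
        (∀ k : ℤ, lam (fun i => ω (i + k)) ≤ 3) ∧
        ∃ k : ℤ, ∀ i : Fin n, w i = ω (k + (i : ℤ))) → w ∈ F := by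
      rintro w ⟨ω, hpos, hlam, k, hk⟩
      rw [funext hk]
      exact hmem ω k (isMarkov_of_lam_le hpos hlam)
    rw [← Nat.card_eq_finsetCard F]
    exact Nat.card_le_card_of_injective (fun w => (⟨w.1, hsub w.1 w.2⟩ : F))
      fun a b hab => Subtype.ext (congrArg (fun x : F => x.1) hab)
  rcases lt_or_ge n 3 with hn3 | hn3
  · refine ⟨Fintype.piFinset fun _ => {1, 2}, ?_, fun ω k h => ?_⟩
    · rw [Fintype.card_piFinset]
      interval_cases n <;> simp
    · simpa using fun i : Fin n => h.eq_one_or_two (k + (i : ℕ))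
  · refine ⟨(Finset.range 2 ×ˢ Finset.range (2 * (n / 2 + 1) + 1) ×ˢ
      Finset.range (2 * (n / 2 + 1)) ×ˢ Finset.range (2 * (n / 2 + 1))).image (lineWord n),
      Finset.card_image_le.trans ?_, fun ω k h => ?_⟩
    · simp only [Finset.card_product, Finset.card_range]
      rcases hn3.eq_or_lt with rfl | hn4
      · norm_num
      · obtain ⟨a, rfl⟩ := Nat.exists_eq_add_of_le (Nat.succ_le_of_lt hn4)
        have hle : 2 * ((Nat.succ 3 + a) / 2 + 1) ≤ a + 6 := by omega
        calc _ ≤ 2 * ((a + 6 + 1) * ((a + 6) * (a + 6))) := by gcongr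
          _ ≤ _ := by simp only [Nat.succ_eq_add_one]; nlinarith [sq_nonneg a, Nat.zero_le (a ^ 3)]
    · obtain ⟨x, hx, hw⟩ := h.exists_lineWord n _ rfl k
      exact Finset.mem_image.2 ⟨x, hx, hw⟩
end
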